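/- Let R be a finite localization of ℤ and M a bounded complex of finitely generated modules over a finitely generated flat R-algebra A. If M ⊗^L_R 𝔽̄_q = 0 for every prime q not invertible in R, then M = 0 in the derived category. -/

import Mathlib

open CategoryTheory Limits

lemma aux_jacobson_int : IsJacobsonRing ℤ := by
  rw [isJacobsonRing_iff_prime_eq]
  intro I hI
  by_cases h : I = ⊥
  · subst h
    rw [eq_bot_iff]
    intro n hn
    by_contra h0
    obtain ⟨p, hp, hpp⟩ := Nat.exists_infinite_primes (n.natAbs + 1)
    have hm : (Ideal.span {(p : ℤ)}).IsMaximal :=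
      PrincipalIdealRing.isMaximal_of_irreducible (Nat.prime_iff_prime_int.mp hpp).irreducible
    rw [Ideal.jacobson, Ideal.mem_sInf] at hn
    have h1 := hn ⟨bot_le, hm⟩
    rw [Ideal.mem_span_singleton] at h1
    have h2 := Int.natAbs_dvd_natAbs.mpr h1
    have h3 : n.natAbs ≠ 0 := by simpa using h0
    have h4 := Nat.le_of_dvd (Nat.pos_of_ne_zero h3) h2
    simp at h4
    omega
  · have := hI.isMaximal h
    exact Ideal.jacobson_eq_self_of_isMaximal

lemma aux_functional {R k : Type} [CommRing R] [CommRing k] (f : R →+* k)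
    (P : CochainComplex (ModuleCat.{0} R) ℤ) (i : ℤ)
    (h : IsZero ((((ModuleCat.extendScalars f).mapHomologicalComplex
          (ComplexShape.up ℤ)).obj P).homology i))
    (x : P.X i) (hx : P.d i (i+1) x = 0)
    (g : P.X i ⟶ (ModuleCat.restrictScalars f).obj (ModuleCat.of k k))
    (hg : P.d (i-1) i ≫ g = 0) : g x = 0 := by
  rw [← HomologicalComplex.exactAt_iff_isZero_homology,
    HomologicalComplex.exactAt_iff' _ (i-1) i (i+1) (by simp) (by simp),
    ShortComplex.moduleCat_exact_iff] at h
  let adj := ModuleCat.extendRestrictScalarsAdj.{0} f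
  let g' := (adj.homEquiv _ _).symm g
  have hg' : (ModuleCat.extendScalars f).map (P.d (i-1) i) ≫ g' = 0 := by
    rw [← Adjunction.homEquiv_naturality_left_symm, hg, Adjunction.homEquiv_counit]
    erw [Functor.map_zero]
    rw [zero_comp]
  let u := (adj.unit.app (P.X i)) x
  obtain ⟨w, hw⟩ := h u (by
    have := congrArg (fun t => t.hom x) (adj.unit.naturality (P.d i (i+1)))
    change adj.unit.app (P.X (i+1)) (P.d i (i+1) x) = _ at this
    rw [hx, map_zero] at this
    exact this.symm)
  have e : g = adj.unit.app _ ≫ (ModuleCat.restrictScalars f).map g' := by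
    have e1 := (adj.homEquiv _ _).apply_symm_apply g
    rw [Adjunction.homEquiv_unit] at e1
    exact e1.symm
  rw [e]
  change g' u = 0
  rw [← hw]
  exact congrArg (fun t => t.hom w) hg'

lemma aux_surj {R : Type} [CommRing R] (I : Ideal R) [I.IsMaximal] (q : ℕ) (hq : q.Prime)
    (hchar : CharP (R ⧸ I) q) (r : R) (hI : I = Ideal.span {r})
    (P : CochainComplex (ModuleCat.{0} R) ℤ) (i : ℤ)
    (hreg : IsSMulRegular (P.X (i+1)) r)
    (hzero : ∀ (q : ℕ), q.Prime → ∀ (k : Type) [Field k] [IsAlgClosed k] [CharP k q]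
      [Algebra R k],
      ∀ i : ℤ,
        IsZero ((((ModuleCat.extendScalars (algebraMap R k)).mapHomologicalComplex
          (ComplexShape.up ℤ)).obj P).homology i))
    (x : P.X i) (hx : P.d i (i+1) x = 0) :
    ∃ (y : P.X (i-1)) (z : P.X i), P.d i (i+1) z = 0 ∧ x = P.d (i-1) i y + r • z := by
  let _ : Field (R ⧸ I) := Ideal.Quotient.field I
  let k := AlgebraicClosure (R ⧸ I)
  have : CharP k q := charP_of_injective_algebraMap (algebraMap (R ⧸ I) k).injective q
  have h0 := hzero q hq k i
  let N : Submodule R (P.X i) := LinearMap.range (P.d (i-1) i).hom ⊔ I • ⊤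
  have key : x ∈ N := by
    by_contra hxN
    let Q := (P.X i) ⧸ N
    have htors : Module.IsTorsionBySet R Q I := by
      rintro m ⟨a, ha⟩
      obtain ⟨m, rfl⟩ := Submodule.Quotient.mk_surjective _ m
      change a • Submodule.Quotient.mk m = 0
      rw [← Submodule.Quotient.mk_smul, Submodule.Quotient.mk_eq_zero]
      exact Submodule.mem_sup_right (Submodule.smul_mem_smul ha trivial)
    let _ : Module (R ⧸ I) Q := htors.module
    have : IsScalarTower R (R ⧸ I) Q := htors.isScalarTower
    let xb : Q := Submodule.Quotient.mk x
    have hxb : xb ≠ 0 := by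
      intro h
      exact hxN ((Submodule.Quotient.mk_eq_zero N).mp h)
    obtain ⟨l, hl⟩ := Module.Projective.exists_dual_ne_zero (R ⧸ I) hxb
    let g0 : P.X i →ₗ[R] k :=
      (Algebra.linearMap (R ⧸ I) k).restrictScalars R ∘ₗ l.restrictScalars R ∘ₗ N.mkQ
    let g : P.X i ⟶ (ModuleCat.restrictScalars (algebraMap R k)).obj (ModuleCat.of k k) :=
      ModuleCat.ofHom (Y := (ModuleCat.restrictScalars (algebraMap R k)).obj (ModuleCat.of k k))
        { toFun := g0
          map_add' := g0.map_add
          map_smul' := fun a b => by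
            rw [g0.map_smul, Algebra.smul_def]; rfl }
    have hgx := aux_functional (algebraMap R k) P i h0 x hx g (by
      ext y
      change algebraMap (R ⧸ I) k (l (Submodule.Quotient.mk (P.d (i-1) i y))) = 0
      rw [(Submodule.Quotient.mk_eq_zero N).mpr (Submodule.mem_sup_left ⟨y, rfl⟩)]
      simp)
    change algebraMap (R ⧸ I) k (l xb) = 0 at hgx
    exact hl ((map_eq_zero _).mp hgx)
  obtain ⟨_, ⟨y, rfl⟩, b, hb, hab⟩ := Submodule.mem_sup.mp key
  rw [hI, Submodule.ideal_span_singleton_smul] at hb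
  obtain ⟨z, -, rfl⟩ := hb
  refine ⟨y, z, ?_, hab.symm⟩
  apply hreg
  change r • _ = r • _
  rw [smul_zero, ← map_smul]
  have e2 : P.d i (i+1) (P.d (i-1) i y) = 0 := by
    have := congrArg (fun t => t.hom y) (P.d_comp_d (i-1) i (i+1))
    exact this
  have e3 := congrArg (P.d i (i+1)) hab
  rw [hx, map_add] at e3
  erw [e2] at e3
  rw [zero_add] at e3
  exact e3

lemma aux_homology_surj {R : Type} [CommRing R] (r : R)
    (P : CochainComplex (ModuleCat.{0} R) ℤ) (i : ℤ)
    (h : ∀ x : P.X i, P.d i (i+1) x = 0 →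
      ∃ (y : P.X (i-1)) (z : P.X i), P.d i (i+1) z = 0 ∧ x = P.d (i-1) i y + r • z)
    (c : P.homology i) : ∃ c' : P.homology i, c = r • c' := by
  obtain ⟨c, rfl⟩ := (ModuleCat.epi_iff_surjective (P.homologyπ i)).mp inferInstance c
  have hinj := (ModuleCat.mono_iff_injective (P.iCycles i)).mp inferInstance
  obtain ⟨y, z, hz, hyz⟩ := h (P.iCycles i c) (by
    have := congrArg (fun t => t.hom c) (P.iCycles_d i (i+1))
    exact this)
  let zc : P.cycles i := P.cyclesMk z (i+1) (by simp) hz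
  have hzc : P.iCycles i zc = z := P.i_cyclesMk z (i+1) (by simp) hz
  refine ⟨P.homologyπ i zc, ?_⟩
  have hc : c = P.toCycles (i-1) i y + r • zc := by
    apply hinj
    rw [hyz, map_add, map_smul, hzc]
    congr 1
    exact (congrArg (fun t => t.hom y) (P.toCycles_i (i-1) i)).symm
  rw [hc, map_add, map_smul]
  have : P.homologyπ i (P.toCycles (i-1) i y) = 0 :=
    congrArg (fun t => t.hom y) (P.toCycles_comp_homologyπ (i-1) i)
  rw [this, zero_add]

theorem derived_base_change_zero_implies_zero
    (R : Type) [CommRing R] (Smon : Submonoid ℤ) (hfg : Smon.FG) [IsLocalization Smon R]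
    (A : Type) [CommRing A] [Algebra R A] [Module.Flat R A] (hA : Algebra.FiniteType R A)
    (M : CochainComplex (ModuleCat.{0} A) ℤ)
    (hbdd : ∃ a b : ℤ, ∀ i : ℤ, (i < a ∨ b < i) → IsZero (M.X i))
    (hfin : ∀ i : ℤ, Module.Finite A (M.homology i))
    -- a flat resolution of `M` as a complex of `R`-modules, used to compute `M ⊗^L_R k`
    (P : CochainComplex (ModuleCat.{0} R) ℤ)
    (hPflat : ∀ i : ℤ, Module.Flat R (P.X i))
    (φ : P ⟶ ((ModuleCat.restrictScalars (algebraMap R A)).mapHomologicalComplex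
        (ComplexShape.up ℤ)).obj M)
    (hφ : QuasiIso φ)
    (hzero : ∀ (q : ℕ), q.Prime → ∀ (k : Type) [Field k] [IsAlgClosed k] [CharP k q]
      [Algebra R k],
      ∀ i : ℤ,
        IsZero ((((ModuleCat.extendScalars (algebraMap R k)).mapHomologicalComplex
          (ComplexShape.up ℤ)).obj P).homology i)) :
    ∀ i : ℤ, IsZero (M.homology i) := by
  intro i
  have hfi := hfin i
  by_contra hne
  have hann : Module.annihilator A (M.homology i) ≠ ⊤ := by
    intro h
    apply hne
    have : Subsingleton (M.homology i) := Module.annihilator_eq_top_iff.mp h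
    exact ModuleCat.isZero_of_subsingleton _
  obtain ⟨J, hJ, hJann⟩ := Ideal.exists_le_maximal _ hann
  have := aux_jacobson_int
  have : Monoid.FG Smon := (Monoid.fg_iff_submonoid_fg Smon).mpr hfg
  have hR : Algebra.FiniteType ℤ R := IsLocalization.finiteType_of_monoid_fg Smon R
  have hAZ : Algebra.FiniteType ℤ A := Algebra.FiniteType.trans hR hA
  let _ : Field (A ⧸ J) := Ideal.Quotient.field J
  have : Algebra.FiniteType ℤ (A ⧸ J) := inferInstance
  have : Module.Finite ℤ (A ⧸ J) := finite_of_finite_type_of_isJacobsonRing ℤ (A ⧸ J)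
  let I : Ideal R := J.comap (algebraMap R A)
  have : IsJacobsonRing R := isJacobsonRing_of_finiteType (A := ℤ)
  have : Module.Finite R (A ⧸ J) := finite_of_finite_type_of_isJacobsonRing R (A ⧸ J)
  have hI : I.IsMaximal := by
    have h1 := Ideal.isMaximal_comap_of_isIntegral_of_isMaximal (R := R) (S := A ⧸ J) ⊥
    have h2 : Ideal.comap (algebraMap R (A ⧸ J)) ⊥ = I := by
      ext a
      rw [Ideal.mem_comap, Ideal.mem_comap, Ideal.mem_bot,
        IsScalarTower.algebraMap_apply R A (A ⧸ J),
        Ideal.Quotient.algebraMap_eq, Ideal.Quotient.eq_zero_iff_mem]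
    rwa [← h2]
  have hRn : Nontrivial R := ⟨0, 1, fun h => hI.ne_top (by
    rw [Ideal.eq_top_iff_one, ← h]; exact I.zero_mem)⟩
  -- the contraction to `ℤ`
  have hmZ : (I.comap (algebraMap ℤ R)).IsMaximal := by
    have h1 := Ideal.isMaximal_comap_of_isIntegral_of_isMaximal (R := ℤ) (S := A ⧸ J) ⊥
    have h2 : Ideal.comap (algebraMap ℤ (A ⧸ J)) ⊥ = I.comap (algebraMap ℤ R) := by
      ext a
      rw [Ideal.mem_comap, Ideal.mem_comap, Ideal.mem_comap, Ideal.mem_bot,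
        ← IsScalarTower.algebraMap_apply, IsScalarTower.algebraMap_apply ℤ A (A ⧸ J),
        Ideal.Quotient.algebraMap_eq, Ideal.Quotient.eq_zero_iff_mem]
    rwa [← h2]
  obtain ⟨n, hn⟩ := IsPrincipalIdealRing.principal (I.comap (algebraMap ℤ R))
  have hn0 : n ≠ 0 := by
    rintro rfl
    rw [Submodule.span_singleton_eq_bot.mpr rfl] at hn
    rw [hn] at hmZ
    exact Ring.ne_bot_of_isMaximal_of_not_isField hmZ Int.not_isField rfl
  have hIspan : I = Ideal.span {algebraMap ℤ R n} := by
    rw [← IsLocalization.map_under Smon R I]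
    change Ideal.map _ (I.comap (algebraMap ℤ R)) = _
    rw [hn]
    change Ideal.map _ (Ideal.span _) = _
    rw [Ideal.map_span, Set.image_singleton]
  have hS : Smon ≤ nonZeroDivisors ℤ := by
    apply le_nonZeroDivisors_of_noZeroDivisors
    intro h0
    have := IsLocalization.map_units R (⟨0, h0⟩ : Smon)
    simp at this
  have hdom : IsDomain R := IsLocalization.isDomain_of_le_nonZeroDivisors R hS
  have hinj : Function.Injective (algebraMap ℤ R) := IsLocalization.injective R hS
  have hr0 : algebraMap ℤ R n ≠ 0 := by
    intro h; exact hn0 (hinj (by rw [h, map_zero]))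
  obtain ⟨q, hq⟩ := CharP.exists (R ⧸ I)
  have hqp : q.Prime := by
    rcases CharP.char_is_prime_or_zero (R ⧸ I) q with h | h
    · exact h
    · exfalso
      subst h
      have hz : ((n : ℤ) : R ⧸ I) = 0 := by
        have : algebraMap ℤ R n ∈ I := by
          rw [hIspan]; exact Ideal.mem_span_singleton_self _
        rw [← Ideal.Quotient.eq_zero_iff_mem] at this
        simpa using this
      rw [CharP.intCast_eq_zero_iff (R ⧸ I) 0] at hz
      simp at hz
      exact hn0 hz
  have hsurj := aux_homology_surj (algebraMap ℤ R n) P i (aux_surj I q hqp hq _ hIspan P i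
    (by
      have := hPflat (i+1)
      exact Module.Flat.isSMulRegular_of_nonZeroDivisors (mem_nonZeroDivisors_of_ne_zero hr0))
    hzero)
  let F := ModuleCat.restrictScalars.{0} (algebraMap R A)
  let e : P.homology i ≅ F.obj (M.homology i) :=
    asIso (HomologicalComplex.homologyMap φ i) ≪≫ (M.sc i).mapHomologyIso F
  have hsurjM : ∀ c : M.homology i, ∃ c' : M.homology i,
      c = algebraMap R A (algebraMap ℤ R n) • c' := by
    intro c
    obtain ⟨d, hd⟩ := hsurj (e.toLinearEquiv.symm c)
    refine ⟨e.toLinearEquiv d, ?_⟩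
    have := congrArg e.toLinearEquiv hd
    rw [map_smul] at this
    exact (e.toLinearEquiv.apply_symm_apply c).symm.trans this
  obtain ⟨r, hr1, hr2⟩ := Submodule.exists_sub_one_mem_and_smul_eq_zero_of_fg_of_le_smul J
    (⊤ : Submodule A (M.homology i)) Module.Finite.fg_top (by
      intro c _
      obtain ⟨c', rfl⟩ := hsurjM c
      refine Submodule.smul_mem_smul ?_ trivial
      change _ ∈ I
      rw [hIspan]; exact Ideal.mem_span_singleton_self _)
  have hrJ : r ∈ J := hJann (Module.mem_annihilator.mpr fun m => hr2 m trivial)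
  apply hJ.ne_top
  rw [Ideal.eq_top_iff_one]
  have := J.sub_mem hrJ hr1
  simpa using this
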